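/- Minimal total variation forces concentration on curves vanishing only once: Let Ω ⊂ ℝ^d be the closure of a bounded domain, v : X_Ω → ℝ^d and g : X_Ω → ℝ measurable. Let (t ↦ ρ_t) ∈ D_{v,g} and let σ ∈ M⁺₁(𝒮_Ω) be concentrated on H_Ω^{v,g} and satisfy ∫_Ω φ dρ_t = ∫_{𝒮_Ω} h(t)φ(γ(t)) dσ(γ,h) for all φ ∈ C(Ω) and all t ∈ [0,1]. If ‖ρ‖_{M(X_Ω)} ≤ ‖ρ̃‖_{M(X_Ω)} for every ρ̃ ∈ D_{v,g} with ρ̃₀ = ρ₀, then σ is concentrated on 𝒮*_Ω. -/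

import Mathlib

open MeasureTheory Set Filter Topology
open scoped ENNReal NNReal

noncomputable section

namespace Paper

abbrev Euc (d : ℕ) : Type := EuclideanSpace ℝ (Fin d)

abbrev XX (d : ℕ) : Type := ℝ × Euc d

variable {d : ℕ}

/-- `Ω` is the closure of a bounded domain (a nonempty bounded open connected set). -/
def IsClosureOfBoundedDomain (Ω : Set (Euc d)) : Prop :=
  ∃ U : Set (Euc d), IsOpen U ∧ U.Nonempty ∧ IsConnected U ∧
    Bornology.IsBounded U ∧ Ω = closure U

/-- `Ω` is the closure of a bounded convex domain. -/
def IsClosureOfBoundedConvexDomain (Ω : Set (Euc d)) : Prop :=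
  ∃ U : Set (Euc d), IsOpen U ∧ U.Nonempty ∧ Convex ℝ U ∧
    Bornology.IsBounded U ∧ Ω = closure U

/-- clamping of `ℝ` onto `[0,1]`. -/
def clamp (t : ℝ) : ℝ := max 0 (min 1 t)

/-- `t ↦ ρ t` is a narrowly continuous curve (on `[0,1]`) of finite positive
measures concentrated on `Ω`, i.e. an element of `C_w([0,1]; M⁺(Ω))`. -/
def NarrowCurve (Ω : Set (Euc d)) (ρ : ℝ → Measure (Euc d)) : Prop :=
  (∀ t ∈ Icc (0:ℝ) 1, ρ t Ωᶜ = 0 ∧ ρ t Set.univ ≠ ⊤) ∧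
  (∀ φ : Euc d → ℝ, Continuous φ →
      ContinuousOn (fun t => ∫ x, φ x ∂(ρ t)) (Icc (0:ℝ) 1))

/-- Test functions for the continuity equation on `X_Ω = (0,1) × Ω` (no-flux form:
compact support in time, free at the spatial boundary). -/
def IsTest (φ : XX d → ℝ) : Prop :=
  ContDiff ℝ (⊤ : ℕ∞) φ ∧ HasCompactSupport φ ∧
    tsupport φ ⊆ Ioo (0:ℝ) 1 ×ˢ (Set.univ : Set (Euc d))

/-- Distributional solution of `∂ₜ ρ + div (v ρ) = g ρ`. -/
def SolvesCE (ρ : ℝ → Measure (Euc d)) (v : XX d → Euc d) (g : XX d → ℝ) : Prop :=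
  ∀ φ : XX d → ℝ, IsTest φ →
    (∫ t in Ioo (0:ℝ) 1,
      ∫ x, (fderiv ℝ φ (t, x) (1, v (t, x)) + φ (t, x) * g (t, x)) ∂(ρ t)) = 0

/-- The Hellinger–Kantorovich energy `∫₀¹ ∫ (|v|² + g²) dρ_t dt`. -/
def EnergyVG (ρ : ℝ → Measure (Euc d)) (v : XX d → Euc d) (g : XX d → ℝ) : ℝ≥0∞ :=
  ∫⁻ t in Ioo (0:ℝ) 1, ∫⁻ x, ENNReal.ofReal (‖v (t, x)‖ ^ 2 + g (t, x) ^ 2) ∂(ρ t)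

/-- The class `D_{v,g}` of finite-energy narrowly continuous solutions. -/
def Dvg (Ω : Set (Euc d)) (v : XX d → Euc d) (g : XX d → ℝ)
    (ρ : ℝ → Measure (Euc d)) : Prop :=
  NarrowCurve Ω ρ ∧ SolvesCE ρ v g ∧ EnergyVG ρ v g < ⊤

/-- total variation `‖ρ‖_{M(X_Ω)}` of `ρ = dt ⊗ ρ_t`. -/
def TVcurve (ρ : ℝ → Measure (Euc d)) : ℝ≥0∞ :=
  ∫⁻ t in Ioo (0:ℝ) 1, ρ t Set.univ

/-- The cone `𝒞_V = {h δ_γ : h ≥ 0, γ ∈ V}` of weighted Dirac masses. -/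
def coneSet (V : Set (Euc d)) : Set (Measure (Euc d)) :=
  {μ | ∃ (a : ℝ) (x : Euc d), 0 ≤ a ∧ x ∈ V ∧ μ = ENNReal.ofReal a • Measure.dirac x}

/-- The space `𝒮_V` of narrowly continuous curves `[0,1] → 𝒞_V`
(extended to `ℝ` by clamping). -/
structure SCurve (V : Set (Euc d)) where
  toFun : ℝ → Measure (Euc d)
  clamped : ∀ t, toFun t = toFun (clamp t)
  cone : ∀ t, toFun t ∈ coneSet V
  narrow : ∀ φ : Euc d → ℝ, Continuous φ → Continuous fun t => ∫ x, φ x ∂(toFun t)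

/-- The flat distance `D_F` between measures. -/
def flatDist (μ ν : Measure (Euc d)) : ℝ :=
  sSup {r : ℝ | ∃ φ : Euc d → ℝ, Continuous φ ∧ (∀ x, |φ x| ≤ 1) ∧ LipschitzWith 1 φ ∧
        r = (∫ x, φ x ∂μ) - ∫ x, φ x ∂ν}

/-- The supremum distance `D` on `𝒮_V`. -/
def Ddist {V : Set (Euc d)} (η₁ η₂ : SCurve V) : ℝ :=
  sSup {r : ℝ | ∃ t ∈ Icc (0:ℝ) 1, r = flatDist (η₁.toFun t) (η₂.toFun t)}

/-- The topology of `(𝒮_V, D)`, generated by the open `D`-balls. -/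
def Stop (V : Set (Euc d)) : TopologicalSpace (SCurve V) :=
  TopologicalSpace.generateFrom
    {s | ∃ (η₀ : SCurve V) (ε : ℝ), 0 < ε ∧ s = {η | Ddist η₀ η < ε}}

/-- The Borel σ-algebra of `(𝒮_V, D)`. -/
def Sborel (V : Set (Euc d)) : MeasurableSpace (SCurve V) := @borel _ (Stop V)

instance (V : Set (Euc d)) : MeasurableSpace (SCurve V) := Sborel V

/-- `‖h‖_∞` for a curve `ρ_t = h(t) δ_{γ(t)} ∈ 𝒮_V`. -/
def supMass {V : Set (Euc d)} (η : SCurve V) : ℝ≥0∞ :=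
  ⨆ t ∈ Icc (0:ℝ) 1, η.toFun t Set.univ

/-- `AC²[0,1]`: absolutely continuous on `[0,1]` with a.e. derivative in `L²`. -/
def AC2 {F : Type*} [NormedAddCommGroup F] [NormedSpace ℝ F] (f : ℝ → F) : Prop :=
  ∃ f' : ℝ → F, IntegrableOn f' (Icc (0:ℝ) 1) ∧
    IntegrableOn (fun t => ‖f' t‖ ^ 2) (Icc (0:ℝ) 1) ∧
    ∀ t ∈ Icc (0:ℝ) 1, f t = f 0 + ∫ s in (0:ℝ)..t, f' s

/-- `(γ, h)` represents the curve `η ∈ 𝒮_V`, i.e. `η_t = h(t) δ_{γ(t)}` on `[0,1]`. -/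
def Represents {V : Set (Euc d)} (η : SCurve V) (γ : ℝ → Euc d) (h : ℝ → ℝ) : Prop :=
  ∀ t ∈ Icc (0:ℝ) 1, 0 ≤ h t ∧ γ t ∈ V ∧
    η.toFun t = ENNReal.ofReal (h t) • Measure.dirac (γ t)

/-- The set `H_V ⊆ 𝒮_V` of curves `h(t)δ_{γ(t)}` with `h, √h ∈ AC²[0,1]`,
`√h γ ∈ AC²([0,1];ℝ^d)`. -/
def MemH (V : Set (Euc d)) (η : SCurve V) : Prop :=
  ∃ (γ : ℝ → Euc d) (h : ℝ → ℝ), Represents η γ h ∧ AC2 h ∧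
    AC2 (fun t => Real.sqrt (h t)) ∧ AC2 (fun t => Real.sqrt (h t) • γ t)

/-- The set `H_V^{v,g}`: curves in `H_V` solving the characteristic system
`γ' = v(t,γ)` a.e. on `{h>0}` and `h' = g(t,γ) h` a.e. on `(0,1)`. -/
def MemHvg (V : Set (Euc d)) (v : XX d → Euc d) (g : XX d → ℝ) (η : SCurve V) : Prop :=
  ∃ (γ : ℝ → Euc d) (h : ℝ → ℝ), Represents η γ h ∧ AC2 h ∧
    AC2 (fun t => Real.sqrt (h t)) ∧ AC2 (fun t => Real.sqrt (h t) • γ t) ∧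
    (∀ᵐ t ∂(volume.restrict {t | t ∈ Ioo (0:ℝ) 1 ∧ 0 < h t}),
        HasDerivAt γ (v (t, γ t)) t) ∧
    (∀ᵐ t ∂(volume.restrict (Ioo (0:ℝ) 1)),
        HasDerivAt h (g (t, γ t) * h t) t)

/-- The set `𝒮*_V` of curves whose positivity set `{h > 0}` is `[0,1] ∩ (-∞, τ)`. -/
def MemSstar {V : Set (Euc d)} (η : SCurve V) : Prop :=
  ∃ τ : ℝ, {t | t ∈ Icc (0:ℝ) 1 ∧ η.toFun t Set.univ ≠ 0} = Icc (0:ℝ) 1 ∩ Iio τ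

/-- The vanishing time `τ(γ,h) = min { t ∈ [0,1] : h(t) = 0 }` (`∞` if none). -/
def tauS {V : Set (Euc d)} (η : SCurve V) : ℝ≥0∞ :=
  sInf {c : ℝ≥0∞ | ∃ t ∈ Icc (0:ℝ) 1, η.toFun t Set.univ = 0 ∧ c = ENNReal.ofReal t}


open Classical in
/-- The integrand `Ψ_δ(t,x,y)`. -/
def Psi (δ : ℝ) (t : ℝ) (x : Euc d) (y : ℝ) : ℝ≥0∞ :=
  if 0 < t then ENNReal.ofReal ((‖x‖ ^ 2 + δ ^ 2 * y ^ 2) / (2 * t))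
  else if t = 0 ∧ x = 0 ∧ y = 0 then 0 else ⊤

/-- `u` is a density of the signed measure `σ` with respect to `lam`. -/
def IsDensityS (σ : SignedMeasure (XX d)) (lam : Measure (XX d)) (u : XX d → ℝ) : Prop :=
  ∀ s : Set (XX d), MeasurableSet s → σ s = ∫ x in s, u x ∂lam

/-- `w` is a density of the vector measure `m` with respect to `lam`. -/
def IsDensityV (m : VectorMeasure (XX d) (Euc d)) (lam : Measure (XX d))
    (w : XX d → Euc d) : Prop :=
  ∀ s : Set (XX d), MeasurableSet s → m s = ∫ x in s, w x ∂lam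

/-- `r` is a density of the positive measure `P` with respect to `lam`. -/
def IsDensityP (P : Measure (XX d)) (lam : Measure (XX d)) (r : XX d → ℝ) : Prop :=
  ∀ s : Set (XX d), MeasurableSet s → P s = ∫⁻ x in s, ENNReal.ofReal (r x) ∂lam

/-- `(P, m, μ)` is a measure solution of `∂ₜ ρ + div m = μ` (with `P` positive). -/
def SolvesCEMeas (P : Measure (XX d)) (m : VectorMeasure (XX d) (Euc d))
    (μ : SignedMeasure (XX d)) : Prop :=
  ∀ (lam : Measure (XX d)), IsFiniteMeasure lam →
    ∀ (w : XX d → Euc d) (u : XX d → ℝ), Measurable w → Measurable u →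
      IsDensityV m lam w → IsDensityS μ lam u →
      ∀ φ : XX d → ℝ, IsTest φ →
        ((∫ x, fderiv ℝ φ x ((1:ℝ), (0 : Euc d)) ∂P) +
          (∫ x, fderiv ℝ φ x ((0:ℝ), w x) ∂lam) + ∫ x, φ x * u x ∂lam) = 0

/-- The Wasserstein–Fisher–Rao energy `B_δ(ρ,m,μ)` for a positive `ρ`. -/
def BdeltaMeas (δ : ℝ) (P : Measure (XX d)) (m : VectorMeasure (XX d) (Euc d))
    (μ : SignedMeasure (XX d)) : ℝ≥0∞ :=
  sInf {c : ℝ≥0∞ | ∃ lam : Measure (XX d), IsFiniteMeasure lam ∧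
    ∃ (r : XX d → ℝ) (w : XX d → Euc d) (u : XX d → ℝ),
      Measurable r ∧ Measurable w ∧ Measurable u ∧ (∀ x, 0 ≤ r x) ∧
      IsDensityP P lam r ∧ IsDensityV m lam w ∧ IsDensityS μ lam u ∧
      c = ∫⁻ x, Psi δ (r x) (w x) (u x) ∂lam}

open Classical in
/-- The coercive energy `J_{α,β,δ}(ρ,m,μ)` for a positive `ρ`. -/
def JMeas (α β δ : ℝ) (P : Measure (XX d)) (m : VectorMeasure (XX d) (Euc d))
    (μ : SignedMeasure (XX d)) : ℝ≥0∞ :=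
  if SolvesCEMeas P m μ then
    ENNReal.ofReal β * BdeltaMeas δ P m μ + ENNReal.ofReal α * P Set.univ
  else ⊤

/-- `(ρ, m, μ)` is a measure solution of `∂ₜ ρ + div m = μ` (signed case). -/
def SolvesCESigned (ρ : SignedMeasure (XX d)) (m : VectorMeasure (XX d) (Euc d))
    (μ : SignedMeasure (XX d)) : Prop :=
  ∀ (lam : Measure (XX d)), IsFiniteMeasure lam →
    ∀ (r : XX d → ℝ) (w : XX d → Euc d) (u : XX d → ℝ),
      Measurable r → Measurable w → Measurable u →
      IsDensityS ρ lam r → IsDensityV m lam w → IsDensityS μ lam u →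
      ∀ φ : XX d → ℝ, IsTest φ →
        (∫ x, (fderiv ℝ φ x ((1:ℝ), (0 : Euc d)) * r x
          + fderiv ℝ φ x ((0:ℝ), w x) + φ x * u x) ∂lam) = 0

/-- The Wasserstein–Fisher–Rao energy `B_δ(ρ,m,μ)`, signed case. -/
def BdeltaSigned (δ : ℝ) (ρ : SignedMeasure (XX d)) (m : VectorMeasure (XX d) (Euc d))
    (μ : SignedMeasure (XX d)) : ℝ≥0∞ :=
  sInf {c : ℝ≥0∞ | ∃ lam : Measure (XX d), IsFiniteMeasure lam ∧
    ∃ (r : XX d → ℝ) (w : XX d → Euc d) (u : XX d → ℝ),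
      Measurable r ∧ Measurable w ∧ Measurable u ∧
      IsDensityS ρ lam r ∧ IsDensityV m lam w ∧ IsDensityS μ lam u ∧
      c = ∫⁻ x, Psi δ (r x) (w x) (u x) ∂lam}

open Classical in
/-- The coercive energy `J_{α,β,δ}(ρ,m,μ)`, signed case. -/
def JSigned (α β δ : ℝ) (ρ : SignedMeasure (XX d)) (m : VectorMeasure (XX d) (Euc d))
    (μ : SignedMeasure (XX d)) : ℝ≥0∞ :=
  if SolvesCESigned ρ m μ then
    ENNReal.ofReal β * BdeltaSigned δ ρ m μ
      + ENNReal.ofReal α * ρ.totalVariation Set.univ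
  else ⊤

/-- A signed measure on `X = ℝ × ℝ^d` is concentrated on `X_Ω = (0,1) × Ω`. -/
def ConcS (Ω : Set (Euc d)) (ρ : SignedMeasure (XX d)) : Prop :=
  ∀ s : Set (XX d), MeasurableSet s → s ⊆ (Ioo (0:ℝ) 1 ×ˢ Ω)ᶜ → ρ s = 0

/-- A vector measure on `X = ℝ × ℝ^d` is concentrated on `X_Ω = (0,1) × Ω`. -/
def ConcV (Ω : Set (Euc d)) (m : VectorMeasure (XX d) (Euc d)) : Prop :=
  ∀ s : Set (XX d), MeasurableSet s → s ⊆ (Ioo (0:ℝ) 1 ×ˢ Ω)ᶜ → m s = 0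

/-- Integral of `φ` against a signed measure. -/
def sInt {α : Type*} [MeasurableSpace α] (σ : SignedMeasure α) (φ : α → ℝ) : ℝ :=
  (∫ x, φ x ∂σ.toJordanDecomposition.posPart) -
    ∫ x, φ x ∂σ.toJordanDecomposition.negPart

/-- Triples `(ρ, m, μ) ∈ M(X_Ω) × M(X_Ω; ℝ^d) × M(X_Ω)`. -/
abbrev Mtriple (d : ℕ) : Type :=
  SignedMeasure (XX d) × VectorMeasure (XX d) (Euc d) × SignedMeasure (XX d)

/-- `P` is the measure `dt ⊗ ρ_t` associated with the curve `η ∈ 𝒮_V`. -/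
def CurveMeasure {V : Set (Euc d)} (η : SCurve V) (P : Measure (XX d)) : Prop :=
  ∀ s : Set (XX d), MeasurableSet s →
    P s = ∫⁻ t in Ioo (0:ℝ) 1, η.toFun t {x | (t, x) ∈ s}

/-- `h'` and `γ'` are the a.e. derivatives of `h` on `(0,1)` and of `γ` on `{h>0}`. -/
def HasAEDerivs (γ : ℝ → Euc d) (h : ℝ → ℝ) (γ' : ℝ → Euc d) (h' : ℝ → ℝ) : Prop :=
  (∀ᵐ t ∂(volume.restrict (Ioo (0:ℝ) 1)), HasDerivAt h (h' t) t) ∧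
  (∀ᵐ t ∂(volume.restrict {t | t ∈ Ioo (0:ℝ) 1 ∧ 0 < h t}), HasDerivAt γ (γ' t) t)

/-- The triple `p = (ρ, m, μ)` is of characteristic form
`ρ = h dt ⊗ δ_γ`, `m = γ' ρ`, `μ = h' dt ⊗ δ_γ` with the regularity of `H_Ω`. -/
def CharRepr (Ω : Set (Euc d)) (γ : ℝ → Euc d) (h : ℝ → ℝ) (γ' : ℝ → Euc d)
    (h' : ℝ → ℝ) (p : Mtriple d) : Prop :=
  (∀ t ∈ Icc (0:ℝ) 1, 0 ≤ h t ∧ γ t ∈ Ω) ∧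
  AC2 h ∧ AC2 (fun t => Real.sqrt (h t)) ∧ AC2 (fun t => Real.sqrt (h t) • γ t) ∧
  (∀ φ : Euc d → ℝ, Continuous φ →
      ContinuousOn (fun t => h t * φ (γ t)) (Icc (0:ℝ) 1)) ∧
  HasAEDerivs γ h γ' h' ∧
  (∀ s : Set (XX d), MeasurableSet s →
      p.1 s = ∫ t in Ioo (0:ℝ) 1, Set.indicator {u : ℝ | (u, γ u) ∈ s} h t) ∧
  (∀ s : Set (XX d), MeasurableSet s →
      p.2.1 s = ∫ t in Ioo (0:ℝ) 1,
        Set.indicator {u : ℝ | (u, γ u) ∈ s} (fun u => h u • γ' u) t) ∧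
  (∀ s : Set (XX d), MeasurableSet s →
      p.2.2 s = ∫ t in Ioo (0:ℝ) 1, Set.indicator {u : ℝ | (u, γ u) ∈ s} h' t)

/-- The set `𝒞` of extremal characteristic triples. -/
def MemC (α β δ : ℝ) (Ω : Set (Euc d)) (p : Mtriple d) : Prop :=
  ∃ (γ : ℝ → Euc d) (h : ℝ → ℝ) (γ' : ℝ → Euc d) (h' : ℝ → ℝ),
    CharRepr Ω γ h γ' h' p ∧
    IsPreconnected {t | t ∈ Icc (0:ℝ) 1 ∧ 0 < h t} ∧
    JSigned α β δ p.1 p.2.1 p.2.2 = 1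


/-- Curves in `C_w([0,1]; M(Ω))`: narrowly continuous curves of signed measures
concentrated on `Ω`, extended to `ℝ` by clamping. -/
def IsCwCurve (Ω : Set (Euc d)) (f : ℝ → SignedMeasure (Euc d)) : Prop :=
  (∀ t, f t = f (clamp t)) ∧
  (∀ t, ∀ s : Set (Euc d), MeasurableSet s → s ⊆ Ωᶜ → f t s = 0) ∧
  (∀ φ : Euc d → ℝ, Continuous φ → Continuous fun t => sInt (f t) φ)

/-- `r` is a density with respect to `lam` of the measure `dt ⊗ f_t` on `X`. -/
def CwDensity (f : ℝ → SignedMeasure (Euc d)) (lam : Measure (XX d))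
    (r : XX d → ℝ) : Prop :=
  ∀ s : Set (XX d), MeasurableSet s →
    (∫ t in Ioo (0:ℝ) 1,
        sInt (f t) ({x : Euc d | (t, x) ∈ s}.indicator fun _ => (1:ℝ)))
      = ∫ x in s, r x ∂lam

/-- `(f, m, μ)` is a measure solution of `∂ₜ ρ + div m = μ`, `f` a curve. -/
def SolvesCECw (f : ℝ → SignedMeasure (Euc d)) (m : VectorMeasure (XX d) (Euc d))
    (μ : SignedMeasure (XX d)) : Prop :=
  ∀ (lam : Measure (XX d)), IsFiniteMeasure lam →
    ∀ (w : XX d → Euc d) (u : XX d → ℝ), Measurable w → Measurable u →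
      IsDensityV m lam w → IsDensityS μ lam u →
      ∀ φ : XX d → ℝ, IsTest φ →
        ((∫ t in Ioo (0:ℝ) 1, sInt (f t) fun x => fderiv ℝ φ (t, x) ((1:ℝ), (0 : Euc d)))
          + (∫ x, fderiv ℝ φ x ((0:ℝ), w x) ∂lam) + ∫ x, φ x * u x ∂lam) = 0

/-- `B_δ(dt ⊗ f_t, m, μ)`. -/
def BdeltaCw (δ : ℝ) (f : ℝ → SignedMeasure (Euc d)) (m : VectorMeasure (XX d) (Euc d))
    (μ : SignedMeasure (XX d)) : ℝ≥0∞ :=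
  sInf {c : ℝ≥0∞ | ∃ lam : Measure (XX d), IsFiniteMeasure lam ∧
    ∃ (r : XX d → ℝ) (w : XX d → Euc d) (u : XX d → ℝ),
      Measurable r ∧ Measurable w ∧ Measurable u ∧
      CwDensity f lam r ∧ IsDensityV m lam w ∧ IsDensityS μ lam u ∧
      c = ∫⁻ x, Psi δ (r x) (w x) (u x) ∂lam}

/-- `‖dt ⊗ f_t‖_{M(X_Ω)}`. -/
def TVCw (f : ℝ → SignedMeasure (Euc d)) : ℝ≥0∞ :=
  ∫⁻ t in Ioo (0:ℝ) 1, (f t).totalVariation Set.univ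

open Classical in
/-- `J_{α,β,δ}(dt ⊗ f_t, m, μ)`. -/
def JCw (α β δ : ℝ) (f : ℝ → SignedMeasure (Euc d)) (m : VectorMeasure (XX d) (Euc d))
    (μ : SignedMeasure (XX d)) : ℝ≥0∞ :=
  if SolvesCECw f m μ then
    ENNReal.ofReal β * BdeltaCw δ f m μ + ENNReal.ofReal α * TVCw f
  else ⊤

/-- The set `𝒞` in curve form: `(f, m, μ)` with `f_t = h(t) δ_{γ(t)}`,
`m = h γ' dt ⊗ δ_γ`, `μ = h' dt ⊗ δ_γ`, with `H_Ω`-regularity, connected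
positivity set and unit energy. -/
def MemCCw (α β δ : ℝ) (Ω : Set (Euc d)) (f : ℝ → SignedMeasure (Euc d))
    (m : VectorMeasure (XX d) (Euc d)) (μ : SignedMeasure (XX d)) : Prop :=
  ∃ (γ : ℝ → Euc d) (h : ℝ → ℝ) (γ' : ℝ → Euc d) (h' : ℝ → ℝ),
    (∀ t ∈ Icc (0:ℝ) 1, 0 ≤ h t ∧ γ t ∈ Ω) ∧
    AC2 h ∧ AC2 (fun t => Real.sqrt (h t)) ∧ AC2 (fun t => Real.sqrt (h t) • γ t) ∧
    (∀ φ : Euc d → ℝ, Continuous φ →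
        ContinuousOn (fun t => h t * φ (γ t)) (Icc (0:ℝ) 1)) ∧
    HasAEDerivs γ h γ' h' ∧
    (∀ t, f t = h (clamp t) • (Measure.dirac (γ (clamp t))).toSignedMeasure) ∧
    (∀ s : Set (XX d), MeasurableSet s →
        m s = ∫ t in Ioo (0:ℝ) 1,
          Set.indicator {u : ℝ | (u, γ u) ∈ s} (fun u => h u • γ' u) t) ∧
    (∀ s : Set (XX d), MeasurableSet s →
        μ s = ∫ t in Ioo (0:ℝ) 1, Set.indicator {u : ℝ | (u, γ u) ∈ s} h' t) ∧
    IsPreconnected {t | t ∈ Icc (0:ℝ) 1 ∧ 0 < h t} ∧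
    JCw α β δ f m μ = 1

/-- The mollified density `ρ_t ∗ ξ_ε + ε χ_V`. -/
def mollDens (V : Set (Euc d)) (ρ : ℝ → Measure (Euc d)) (ξ : Euc d → ℝ) (ε : ℝ)
    (t : ℝ) (x : Euc d) : ℝ :=
  (∫ y, (ε ^ d)⁻¹ * ξ (ε⁻¹ • (x - y)) ∂(ρ t)) + ε * V.indicator (fun _ => (1:ℝ)) x

/-- The mollified measure `ρ_t^ε = (ρ_t ∗ ξ_ε + ε χ_V) dx`. -/
def mollRho (V : Set (Euc d)) (ρ : ℝ → Measure (Euc d)) (ξ : Euc d → ℝ) (ε : ℝ) :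
    ℝ → Measure (Euc d) :=
  fun t => volume.withDensity fun x => ENNReal.ofReal (mollDens V ρ ξ ε t x)

open Classical in
/-- The mollified velocity field `v^ε = ((v ρ_t) ∗ ξ_ε) / ρ_t^ε`. -/
def mollV (V : Set (Euc d)) (ρ : ℝ → Measure (Euc d)) (v : XX d → Euc d)
    (ξ : Euc d → ℝ) (ε : ℝ) : XX d → Euc d :=
  fun p => if mollDens V ρ ξ ε p.1 p.2 = 0 then 0 else
    (mollDens V ρ ξ ε p.1 p.2)⁻¹ •
      ∫ y, ((ε ^ d)⁻¹ * ξ (ε⁻¹ • (p.2 - y))) • v (p.1, y) ∂(ρ p.1)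

open Classical in
/-- The mollified growth field `g^ε = ((g ρ_t) ∗ ξ_ε) / ρ_t^ε`. -/
def mollG (V : Set (Euc d)) (ρ : ℝ → Measure (Euc d)) (g : XX d → ℝ)
    (ξ : Euc d → ℝ) (ε : ℝ) : XX d → ℝ :=
  fun p => if mollDens V ρ ξ ε p.1 p.2 = 0 then 0 else
    (mollDens V ρ ξ ε p.1 p.2)⁻¹ *
      ∫ y, ((ε ^ d)⁻¹ * ξ (ε⁻¹ • (p.2 - y))) * g (p.1, y) ∂(ρ p.1)


section Helpers

open ProbabilityTheory in
lemma isSFiniteKernel_of_finite {α β : Type*} [MeasurableSpace α] [MeasurableSpace β]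
    (κ : Kernel α β) (hκ : ∀ a, IsFiniteMeasure (κ a)) : IsSFiniteKernel κ := by
  classical
  have hm : Measurable fun a => κ a univ := κ.measurable_coe MeasurableSet.univ
  let s : ℕ → Set α := fun n => {a | ⌊(κ a univ).toReal⌋₊ = n}
  have hs : ∀ n, MeasurableSet (s n) := fun n =>
    (Nat.measurable_floor.comp hm.ennreal_toReal) (measurableSet_singleton n)
  refine ⟨fun n => Kernel.piecewise (hs n) κ 0, fun n => ⟨⟨(n:ℝ≥0∞) + 1, by finiteness, ?_⟩⟩, ?_⟩
  · intro a
    rw [Kernel.piecewise_apply]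
    split_ifs with h
    · have h1 : (κ a univ).toReal < n + 1 := by
        have := Nat.lt_floor_add_one (κ a univ).toReal
        have h' : ⌊(κ a univ).toReal⌋₊ = n := h
        rwa [h'] at this
      rw [← ENNReal.ofReal_toReal (measure_ne_top (κ a) univ)]
      refine (ENNReal.ofReal_le_ofReal h1.le).trans ?_
      rw [ENNReal.ofReal_add (by positivity) (by norm_num)]
      simp
    · simp
  · ext a t ht
    rw [Kernel.sum_apply' _ _ ht, tsum_eq_single ⌊(κ a univ).toReal⌋₊]
    · rw [Kernel.piecewise_apply, if_pos]
      rfl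
    · intro n hn
      rw [Kernel.piecewise_apply, if_neg]
      · simp
      · intro h
        exact hn h.symm

variable {V : Set (Euc d)}

instance instFinSC (η : SCurve V) (t : ℝ) : IsFiniteMeasure (η.toFun t) := by
  obtain ⟨a, x, ha, hx, h⟩ := η.cone t
  rw [h]
  refine ⟨?_⟩
  simp

/-- The mass `h(t)`. -/
def mass (η : SCurve V) (t : ℝ) : ℝ := (η.toFun t).real univ

lemma mass_cont (η : SCurve V) : Continuous (mass η) := by
  have := η.narrow (fun _ => 1) continuous_const
  simp only [integral_const, smul_eq_mul, mul_one] at this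
  exact this

lemma mass_nonneg (η : SCurve V) (t : ℝ) : 0 ≤ mass η t := measureReal_nonneg

lemma abs_integral_le (η : SCurve V) (t : ℝ) {φ : Euc d → ℝ} {C : ℝ}
    (hC : ∀ x ∈ V, |φ x| ≤ C) : |∫ x, φ x ∂(η.toFun t)| ≤ C * mass η t := by
  obtain ⟨a, x, ha, hx, h⟩ := η.cone t
  rw [mass, h]
  simp [Measure.real, ha, abs_mul, abs_of_nonneg ha]
  rw [mul_comm]
  exact mul_le_mul_of_nonneg_right (hC x hx) ha

lemma mass_clamp (η : SCurve V) (t : ℝ) : mass η t = mass η (clamp t) := by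
  rw [mass, η.clamped]; rfl

lemma clamp_mem (t : ℝ) : clamp t ∈ Icc (0:ℝ) 1 := by
  unfold clamp
  constructor
  · exact le_max_left _ _
  · exact max_le (by norm_num) (min_le_left _ _)

lemma clamp_of_mem {t : ℝ} (ht : t ∈ Icc (0:ℝ) 1) : clamp t = t := by
  unfold clamp
  rw [min_eq_right ht.2, max_eq_right ht.1]

lemma mass_bdd (η : SCurve V) : ∃ C, ∀ t, mass η t ≤ C := by
  obtain ⟨C, hC⟩ := (isCompact_Icc (a := (0:ℝ)) (b := 1)).exists_bound_of_continuousOn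
    (mass_cont η).continuousOn
  refine ⟨C, fun t => ?_⟩
  rw [mass_clamp]
  exact (le_abs_self _).trans (hC _ (clamp_mem t))

lemma le_flatDist (η₁ η₂ : SCurve V) (t : ℝ) {φ : Euc d → ℝ} (hφ : ∀ x, |φ x| ≤ 1)
    (hL : LipschitzWith 1 φ) :
    (∫ x, φ x ∂(η₁.toFun t)) - ∫ x, φ x ∂(η₂.toFun t) ≤
      flatDist (η₁.toFun t) (η₂.toFun t) := by
  refine le_csSup ⟨mass η₁ t + mass η₂ t, ?_⟩ ⟨φ, hL.continuous, hφ, hL, rfl⟩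
  rintro r ⟨ψ, -, hψ, -, rfl⟩
  have h1 := abs_integral_le η₁ t (φ := ψ) (C := 1) (fun x _ => hψ x)
  have h2 := abs_integral_le η₂ t (φ := ψ) (C := 1) (fun x _ => hψ x)
  have h3 := le_abs_self (∫ x, ψ x ∂(η₁.toFun t))
  have h4 := neg_abs_le (∫ x, ψ x ∂(η₂.toFun t))
  linarith

lemma flatDist_le (η₁ η₂ : SCurve V) (t : ℝ) :
    flatDist (η₁.toFun t) (η₂.toFun t) ≤ mass η₁ t + mass η₂ t := by
  refine Real.sSup_le ?_ (add_nonneg (mass_nonneg _ _) (mass_nonneg _ _))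
  rintro r ⟨ψ, -, hψ, -, rfl⟩
  have h1 := abs_integral_le η₁ t (φ := ψ) (C := 1) (fun x _ => hψ x)
  have h2 := abs_integral_le η₂ t (φ := ψ) (C := 1) (fun x _ => hψ x)
  have h3 := le_abs_self (∫ x, ψ x ∂(η₁.toFun t))
  have h4 := neg_abs_le (∫ x, ψ x ∂(η₂.toFun t))
  linarith

lemma le_Ddist (η₁ η₂ : SCurve V) (t : ℝ) {φ : Euc d → ℝ} (hφ : ∀ x, |φ x| ≤ 1)
    (hL : LipschitzWith 1 φ) :
    (∫ x, φ x ∂(η₁.toFun t)) - ∫ x, φ x ∂(η₂.toFun t) ≤ Ddist η₁ η₂ := by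
  rw [η₁.clamped, η₂.clamped]
  refine (le_flatDist η₁ η₂ (clamp t) hφ hL).trans ?_
  obtain ⟨C₁, h₁⟩ := mass_bdd η₁
  obtain ⟨C₂, h₂⟩ := mass_bdd η₂
  refine le_csSup ⟨C₁ + C₂, ?_⟩ ⟨clamp t, clamp_mem t, rfl⟩
  rintro r ⟨s, -, rfl⟩
  exact (flatDist_le η₁ η₂ s).trans (add_le_add (h₁ s) (h₂ s))

lemma Ddist_self (η : SCurve V) : Ddist η η ≤ 0 := by
  refine Real.sSup_le ?_ le_rfl
  rintro r ⟨s, -, rfl⟩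
  refine Real.sSup_le ?_ le_rfl
  rintro r ⟨ψ, -, hψ, -, rfl⟩
  simp

lemma measurable_integral_lip1 (t : ℝ) {φ : Euc d → ℝ} (hφ : ∀ x, |φ x| ≤ 1)
    (hL : LipschitzWith 1 φ) :
    Measurable fun η : SCurve V => ∫ x, φ x ∂(η.toFun t) := by
  let _ : TopologicalSpace (SCurve V) := Stop V
  have : BorelSpace (SCurve V) := ⟨rfl⟩
  apply Continuous.measurable
  rw [continuous_iff_continuousAt]
  intro η₀
  rw [ContinuousAt, Metric.tendsto_nhds]
  intro ε hε
  have hopen : IsOpen {η : SCurve V | Ddist η₀ η < ε} :=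
    TopologicalSpace.isOpen_generateFrom_of_mem ⟨η₀, ε, hε, rfl⟩
  have hmem : {η : SCurve V | Ddist η₀ η < ε} ∈ 𝓝 η₀ :=
    hopen.mem_nhds ((Ddist_self η₀).trans_lt hε)
  filter_upwards [hmem] with η hη
  have h1 := le_Ddist η₀ η t hφ hL
  have h2 := le_Ddist η₀ η t (φ := fun x => - φ x) (by simpa using hφ) hL.neg
  rw [integral_neg, integral_neg] at h2
  rw [Real.dist_eq, abs_lt]
  have h3 : Ddist η₀ η < ε := hη
  constructor <;> linarith

lemma measurable_integral_lip (t : ℝ) {φ : Euc d → ℝ} (hφ : ∀ x, |φ x| ≤ 1) {K : ℝ≥0}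
    (hL : LipschitzWith K φ) :
    Measurable fun η : SCurve V => ∫ x, φ x ∂(η.toFun t) := by
  have hK : (0:ℝ≥0) < max 1 K := lt_of_lt_of_le one_pos (le_max_left _ _)
  have hK' : (0:ℝ) < ((max 1 K : ℝ≥0) : ℝ) := by exact_mod_cast hK
  set c : ℝ := ((max 1 K : ℝ≥0) : ℝ)⁻¹ with hc
  have hc0 : 0 < c := inv_pos.2 hK'
  have hc1 : c ≤ 1 := inv_le_one_of_one_le₀ (by exact_mod_cast le_max_left _ _)
  have h1 : Measurable fun η : SCurve V => ∫ x, c * φ x ∂(η.toFun t) := by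
    apply measurable_integral_lip1
    · intro x
      rw [abs_mul, abs_of_pos hc0]
      calc c * |φ x| ≤ 1 * 1 := mul_le_mul hc1 (hφ x) (abs_nonneg _) zero_le_one
        _ = 1 := one_mul 1
    · refine LipschitzWith.of_dist_le_mul fun x y => ?_
      have := hL.dist_le_mul x y
      rw [Real.dist_eq] at this ⊢
      rw [← mul_sub, abs_mul, abs_of_pos hc0]
      have hKm : (K:ℝ) ≤ ((max 1 K : ℝ≥0) : ℝ) := by exact_mod_cast le_max_right _ _
      calc c * |φ x - φ y| ≤ c * (K * dist x y) := by gcongr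
        _ ≤ c * (((max 1 K : ℝ≥0) : ℝ) * dist x y) := by gcongr
        _ = (1:ℝ≥0) * dist x y := by
          rw [← mul_assoc, hc, inv_mul_cancel₀ hK'.ne']; simp
  have h2 := h1.const_mul c⁻¹
  convert h2 using 2 with η
  rw [integral_const_mul, ← mul_assoc, inv_mul_cancel₀ hc0.ne', one_mul]

lemma measurable_integral_lip_joint {φ : Euc d → ℝ} (hφ : ∀ x, |φ x| ≤ 1) {K : ℝ≥0}
    (hL : LipschitzWith K φ) :
    Measurable fun p : ℝ × SCurve V => ∫ x, φ x ∂(p.2.toFun p.1) :=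
  measurable_uncurry_of_continuous_of_measurable (u := fun t (η : SCurve V) =>
    ∫ x, φ x ∂(η.toFun t)) (fun η => η.narrow φ hL.continuous)
    (fun t => measurable_integral_lip t hφ hL)

lemma measurable_measure_closed {F : Set (Euc d)} (hF : IsClosed F) :
    Measurable fun p : ℝ × SCurve V => p.2.toFun p.1 F := by
  have hpos : ∀ n : ℕ, (0:ℝ) < 1 / ((n:ℝ) + 1) := fun n => Nat.one_div_pos_of_nat
  have key : ∀ p : ℝ × SCurve V, Tendsto (fun n : ℕ => ∫ x,
      (thickenedIndicator (hpos n) F x : ℝ) ∂(p.2.toFun p.1)) atTop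
      (𝓝 ((p.2.toFun p.1).real F)) := fun p =>
    tendsto_integral_thickenedIndicator_of_isClosed _ hF hpos
      tendsto_one_div_add_atTop_nhds_zero_nat
  have hreal : Measurable fun p : ℝ × SCurve V => (p.2.toFun p.1).real F := by
    refine measurable_of_tendsto_metrizable (fun n => ?_) (tendsto_pi_nhds.2 key)
    apply measurable_integral_lip_joint (K := (1 / ((n:ℝ) + 1)).toNNReal⁻¹)
    · intro x
      rw [abs_of_nonneg (NNReal.coe_nonneg _)]
      exact_mod_cast thickenedIndicator_le_one (hpos n) F x
    · refine LipschitzWith.of_dist_le_mul fun x y => ?_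
      exact (lipschitzWith_thickenedIndicator (hpos n) F).dist_le_mul x y
  have := hreal.ennreal_ofReal
  simpa [ofReal_measureReal] using this

lemma measurable_toFun :
    Measurable fun p : ℝ × SCurve V => p.2.toFun p.1 := by
  refine Measurable.measure_of_isPiSystem (S := {s | IsClosed s})
    ?_ isPiSystem_isClosed ?_ ?_
  · rw [BorelSpace.measurable_eq (α := Euc d), borel_eq_generateFrom_isClosed]
  · intro s hs
    exact measurable_measure_closed hs
  · exact measurable_measure_closed isClosed_univ

lemma measurable_mass : Measurable fun p : ℝ × SCurve V => mass p.2 p.1 :=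
  (measurable_measure_closed isClosed_univ).ennreal_toReal

/-- No vanishing on `[0,t]`. -/
def Aset (V : Set (Euc d)) : Set (ℝ × SCurve V) :=
  {p | ∀ r : ℝ, 0 < mass p.2 (clamp r * p.1)}

lemma clamp_cont : Continuous clamp := by unfold clamp; fun_prop

lemma mem_Aset {t : ℝ} (ht : 0 ≤ t) {η : SCurve V} :
    (t, η) ∈ Aset V ↔ ∀ s ∈ Icc 0 t, 0 < mass η s := by
  constructor
  · intro h s hs
    rcases ht.eq_or_lt with rfl | ht'
    · have := h 0
      have hs' : s = 0 := le_antisymm hs.2 hs.1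
      simpa [hs'] using this
    · have := h (s / t)
      rw [clamp_of_mem ⟨div_nonneg hs.1 ht, (div_le_one ht').2 hs.2⟩] at this
      simpa [div_mul_cancel₀ s ht'.ne'] using this
  · intro h r
    have hr := clamp_mem r
    exact h _ ⟨mul_nonneg hr.1 ht, mul_le_of_le_one_left ht hr.2⟩

lemma measurableSet_Aset : MeasurableSet (Aset V) := by
  have : Aset V = ⋃ n : ℕ, ⋂ q : ℚ,
      {p : ℝ × SCurve V | 1 / ((n:ℝ) + 1) ≤ mass p.2 (clamp q * p.1)} := by
    ext ⟨t, η⟩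
    simp only [mem_iUnion, mem_iInter, mem_ofPred_eq]
    have hc : Continuous fun r : ℝ => mass η (clamp r * t) :=
      (mass_cont η).comp (clamp_cont.mul continuous_const)
    constructor
    · intro h
      obtain ⟨r₀, -, hr₀⟩ := (isCompact_Icc (a := (0:ℝ)) (b := 1)).exists_isMinOn
        (nonempty_Icc.2 zero_le_one) hc.continuousOn
      obtain ⟨n, hn⟩ := exists_nat_one_div_lt (h r₀)
      refine ⟨n, fun q => hn.le.trans ?_⟩
      have := hr₀ (clamp_mem q)
      simpa [clamp_of_mem (clamp_mem q)] using this
    · rintro ⟨n, hn⟩ r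
      have hcl : IsClosed {r : ℝ | 1 / ((n:ℝ) + 1) ≤ mass η (clamp r * t)} :=
        isClosed_le continuous_const hc
      have : r ∈ {r : ℝ | 1 / ((n:ℝ) + 1) ≤ mass η (clamp r * t)} :=
        (Rat.denseRange_cast (𝕜 := ℝ)).induction_on r hcl hn
      exact lt_of_lt_of_le Nat.one_div_pos_of_nat this
  rw [this]
  refine MeasurableSet.iUnion fun n => MeasurableSet.iInter fun q => ?_
  refine measurableSet_le measurable_const ?_
  exact measurable_mass.comp ((measurable_fst.const_mul _).prodMk measurable_snd)

/-- The kernel `(t, η) ↦ η_t`. -/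
def kap (V : Set (Euc d)) : ProbabilityTheory.Kernel (ℝ × SCurve V) (Euc d) :=
  ⟨fun p => p.2.toFun p.1, measurable_toFun⟩

lemma kap_apply (p : ℝ × SCurve V) : kap V p = p.2.toFun p.1 := rfl

instance : ProbabilityTheory.IsSFiniteKernel (kap V) :=
  isSFiniteKernel_of_finite _ fun p => instFinSC p.2 p.1

open Classical in
/-- The truncated kernel. -/
def Kap (V : Set (Euc d)) : ProbabilityTheory.Kernel (ℝ × SCurve V) (Euc d) :=
  ProbabilityTheory.Kernel.piecewise (measurableSet_Aset (V := V)) (kap V) 0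

instance : ProbabilityTheory.IsSFiniteKernel (Kap V) := by
  classical
  unfold Kap
  infer_instance

open Classical in
lemma Kap_apply (p : ℝ × SCurve V) :
    Kap V p = if p ∈ Aset V then p.2.toFun p.1 else 0 := by
  rw [Kap, ProbabilityTheory.Kernel.piecewise_apply]
  rfl

lemma Kap_le (p : ℝ × SCurve V) : Kap V p ≤ p.2.toFun p.1 := by
  classical
  rw [Kap_apply]
  split_ifs
  · exact le_rfl
  · exact Measure.zero_le _

lemma ac_of_dist_le {X Y : Type*} [PseudoMetricSpace X] [PseudoMetricSpace Y] {f : ℝ → X}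
    {G : ℝ → Y} {a b : ℝ} (C : ℝ) (hG : AbsolutelyContinuousOnInterval G a b)
    (h : ∀ x ∈ uIcc a b, ∀ y ∈ uIcc a b, dist (f x) (f y) ≤ C * dist (G x) (G y)) :
    AbsolutelyContinuousOnInterval f a b := by
  unfold AbsolutelyContinuousOnInterval at hG ⊢
  have h2 := hG.const_mul C
  rw [mul_zero] at h2
  refine squeeze_zero' (Eventually.of_forall fun E => Finset.sum_nonneg fun i _ => dist_nonneg)
    ?_ h2
  filter_upwards [mem_inf_of_right (mem_principal_self _)] with E hE
  rw [Finset.mul_sum]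
  refine Finset.sum_le_sum fun i hi => ?_
  have := hE.1 i hi
  exact h _ this.1 _ this.2

lemma ac_of_AC2 {F : Type*} [NormedAddCommGroup F] [NormedSpace ℝ F]
    {f : ℝ → F} (hf : AC2 f) : AbsolutelyContinuousOnInterval f 0 1 := by
  obtain ⟨f', h1, -, h3⟩ := hf
  have hi : IntervalIntegrable f' volume 0 1 :=
    (intervalIntegrable_iff_integrableOn_Icc_of_le zero_le_one).2 h1
  have hsub : ∀ x ∈ uIcc (0:ℝ) 1, ∀ y ∈ uIcc (0:ℝ) 1, IntervalIntegrable f' volume x y :=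
    fun x hx y hy => hi.mono_set (uIcc_subset_uIcc hx hy)
  have hG := hi.norm.absolutelyContinuousOnInterval_intervalIntegral
    (c := 0) left_mem_uIcc
  refine ac_of_dist_le 1 hG fun x hx y hy => ?_
  have h0 : (0:ℝ) ∈ uIcc (0:ℝ) 1 := left_mem_uIcc
  have hx' : x ∈ Icc (0:ℝ) 1 := by rwa [uIcc_of_le zero_le_one] at hx
  have hy' : y ∈ Icc (0:ℝ) 1 := by rwa [uIcc_of_le zero_le_one] at hy
  rw [h3 x hx', h3 y hy', dist_add_left, dist_eq_norm, Real.dist_eq, one_mul,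
    intervalIntegral.integral_interval_sub_left (hsub _ h0 _ hx) (hsub _ h0 _ hy),
    intervalIntegral.integral_interval_sub_left (hsub _ h0 _ hx).norm (hsub _ h0 _ hy).norm]
  exact intervalIntegral.norm_integral_le_abs_integral_norm

/-- The integrand of the continuity equation. -/
def FF (v : XX d → Euc d) (g : XX d → ℝ) (φ : XX d → ℝ) (p : XX d) : ℝ :=
  fderiv ℝ φ p (1, v p) + φ p * g p

lemma test_zero {φ : XX d → ℝ} (hφ : IsTest φ) {t : ℝ} (ht : t ∉ Ioo (0:ℝ) 1) (x : Euc d) :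
    φ (t, x) = 0 := by
  by_contra h
  exact ht (hφ.2.2 (subset_tsupport φ h)).1

/-- The chain rule along a characteristic, on an interval without vanishing. -/
lemma char_ftc {v : XX d → Euc d} {g : XX d → ℝ} {γ : ℝ → Euc d} {h : ℝ → ℝ}
    (h1 : AC2 h) (h2 : AC2 (fun t => Real.sqrt (h t)))
    (h3 : AC2 (fun t => Real.sqrt (h t) • γ t))
    (h4 : ∀ᵐ t ∂(volume.restrict {t | t ∈ Ioo (0:ℝ) 1 ∧ 0 < h t}),
        HasDerivAt γ (v (t, γ t)) t)
    (h5 : ∀ᵐ t ∂(volume.restrict (Ioo (0:ℝ) 1)), HasDerivAt h (g (t, γ t) * h t) t)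
    {φ : XX d → ℝ} (hφ : IsTest φ) {b : ℝ} (hb : b ∈ Icc (0:ℝ) 1)
    (hpos : ∀ t ∈ Icc 0 b, 0 < h t) :
    ∫ t in (0:ℝ)..b, h t * FF v g φ (t, γ t) = h b * φ (b, γ b) := by
  have hsub : uIcc 0 b ⊆ uIcc (0:ℝ) 1 := by
    rw [uIcc_of_le hb.1, uIcc_of_le zero_le_one]
    exact Icc_subset_Icc_right hb.2
  have a1 := (ac_of_AC2 h1).mono hsub
  have a2 := (ac_of_AC2 h2).mono hsub
  have a3 := (ac_of_AC2 h3).mono hsub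
  have hu : uIcc 0 b = Icc 0 b := uIcc_of_le hb.1
  -- lower bound for the square root
  obtain ⟨s₀, hs₀, hmin⟩ := (isCompact_Icc (a := (0:ℝ)) (b := b)).exists_isMinOn
    (nonempty_Icc.2 hb.1) (hu ▸ a2.continuousOn)
  set c := Real.sqrt (h s₀) with hc
  have hc0 : 0 < c := Real.sqrt_pos.2 (hpos _ hs₀)
  have hcle : ∀ t ∈ Icc 0 b, c ≤ Real.sqrt (h t) := fun t ht => hmin ht
  have a4 : AbsolutelyContinuousOnInterval (fun t => (Real.sqrt (h t))⁻¹) 0 b := by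
    refine ac_of_dist_le (c⁻¹ * c⁻¹) a2 fun x hx y hy => ?_
    rw [hu] at hx hy
    have hx' := hcle x hx
    have hy' := hcle y hy
    have px := hc0.trans_le hx'
    have py := hc0.trans_le hy'
    rw [Real.dist_eq, Real.dist_eq, inv_sub_inv px.ne' py.ne', abs_div, abs_mul,
      abs_of_pos px, abs_of_pos py, abs_sub_comm, div_eq_inv_mul, mul_inv]
    gcongr
  have a5 : AbsolutelyContinuousOnInterval γ 0 b := by
    refine ac_of_dist_le 1 (a4.smul a3) fun x hx y hy => ?_
    rw [hu] at hx hy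
    have px := hc0.trans_le (hcle x hx)
    have py := hc0.trans_le (hcle y hy)
    simp only [Pi.smul_apply', smul_smul, inv_mul_cancel₀ px.ne', inv_mul_cancel₀ py.ne', one_smul,
      one_mul, le_refl]
  have a6 : AbsolutelyContinuousOnInterval (fun t => ((t, γ t) : XX d)) 0 b := by
    have b1 : AbsolutelyContinuousOnInterval (fun t : ℝ => ((t, 0) : XX d)) 0 b := by
      refine LipschitzOnWith.absolutelyContinuousOnInterval (K := 1) ?_
      refine LipschitzOnWith.of_dist_le_mul fun x _ y _ => ?_
      simp [Prod.dist_eq]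
    have b2 : AbsolutelyContinuousOnInterval (fun t : ℝ => ((0, γ t) : XX d)) 0 b := by
      refine ac_of_dist_le 1 a5 fun x _ y _ => ?_
      simp [Prod.dist_eq]
    have e : (fun t => ((t, γ t) : XX d)) =
        (fun t : ℝ => ((t, 0) : XX d)) + fun t => ((0, γ t) : XX d) := by
      funext t
      simp
    rw [e]
    exact b1.add b2
  obtain ⟨K, hK⟩ := hφ.1.lipschitzWith_of_hasCompactSupport hφ.2.1 (by simp)
  have a7 : AbsolutelyContinuousOnInterval (fun t => φ (t, γ t)) 0 b :=
    ac_of_dist_le K a6 fun x _ y _ => hK.dist_le_mul _ _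
  have a8 := a1.mul a7
  have e1 := a8.integral_deriv_eq_sub
  simp only [Pi.mul_apply, test_zero hφ (t := 0) (by simp), mul_zero, sub_zero] at e1
  rw [← e1]
  rw [intervalIntegral.integral_of_le hb.1, intervalIntegral.integral_of_le hb.1,
    integral_Ioc_eq_integral_Ioo, integral_Ioc_eq_integral_Ioo]
  refine integral_congr_ae ?_
  have s1 : Ioo 0 b ⊆ Ioo (0:ℝ) 1 := Ioo_subset_Ioo_right hb.2
  have s2 : Ioo 0 b ⊆ {t | t ∈ Ioo (0:ℝ) 1 ∧ 0 < h t} := fun t ht =>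
    ⟨s1 ht, hpos t (Ioo_subset_Icc_self ht)⟩
  filter_upwards [ae_mono (Measure.restrict_mono s2 le_rfl) h4,
    ae_mono (Measure.restrict_mono s1 le_rfl) h5] with t ht4 ht5
  have hd : HasFDerivAt φ (fderiv ℝ φ (t, γ t)) (t, γ t) :=
    ((hφ.1.differentiable (by simp)) _).hasFDerivAt
  have hcomp : HasDerivAt (fun t => φ (t, γ t)) (fderiv ℝ φ (t, γ t) (1, v (t, γ t))) t :=
    hd.comp_hasDerivAt (f := fun t => ((t, γ t) : XX d)) t ((hasDerivAt_id t).prodMk ht4)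
  rw [(ht5.mul hcomp).deriv, FF]
  ring

lemma first_zero (η : SCurve V) : (∀ t ∈ Icc (0:ℝ) 1, 0 < mass η t) ∨
    ∃ τ ∈ Icc (0:ℝ) 1, mass η τ = 0 ∧ ∀ t ∈ Ico 0 τ, 0 < mass η t := by
  by_cases hZ : (Icc (0:ℝ) 1 ∩ mass η ⁻¹' {0}).Nonempty
  · right
    have hcomp : IsCompact (Icc (0:ℝ) 1 ∩ mass η ⁻¹' {0}) :=
      isCompact_Icc.inter_right (isClosed_singleton.preimage (mass_cont η))
    obtain ⟨τ, hτ, hmin⟩ := hcomp.exists_isLeast hZ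
    refine ⟨τ, hτ.1, hτ.2, fun t ht => ?_⟩
    refine lt_of_le_of_ne (mass_nonneg _ _) fun h => ?_
    exact absurd (hmin ⟨⟨ht.1, ht.2.le.trans hτ.1.2⟩, h.symm⟩) (not_le.2 ht.2)
  · left
    intro t ht
    refine lt_of_le_of_ne (mass_nonneg _ _) fun h => ?_
    exact hZ ⟨t, ht, h.symm⟩

lemma toFun_eq_zero {η : SCurve V} {t : ℝ} (h : mass η t = 0) : η.toFun t = 0 := by
  rw [mass, Measure.real, ENNReal.toReal_eq_zero_iff] at h
  rcases h with h | h
  · exact Measure.measure_univ_eq_zero.1 h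
  · exact absurd h (measure_ne_top _ _)

/-- Truncated curves are obtained by stopping at a zero. -/
lemma Kap_eq_stopped (η : SCurve V) : ∃ τ : ℝ, ∀ t ∈ Icc (0:ℝ) 1,
    Kap V (t, η) = η.toFun (min t τ) := by
  classical
  rcases first_zero η with h | ⟨τ, hτ, h0, h⟩
  · refine ⟨1, fun t ht => ?_⟩
    rw [Kap_apply, if_pos, min_eq_left ht.2]
    exact (mem_Aset ht.1).2 fun s hs => h s ⟨hs.1, hs.2.trans ht.2⟩
  · refine ⟨τ, fun t ht => ?_⟩
    rw [Kap_apply]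
    rcases lt_or_ge t τ with htτ | htτ
    · rw [if_pos, min_eq_left htτ.le]
      exact (mem_Aset ht.1).2 fun s hs => h s ⟨hs.1, hs.2.trans_lt htτ⟩
    · rw [if_neg, min_eq_right htτ, toFun_eq_zero h0]
      intro hA
      exact absurd ((mem_Aset ht.1).1 hA τ ⟨hτ.1, htτ⟩) (by simp [h0])

lemma trunc_cont (η : SCurve V) {φ : Euc d → ℝ} (hφ : Continuous φ) :
    ContinuousOn (fun t => ∫ x, φ x ∂(Kap V (t, η))) (Icc (0:ℝ) 1) := by
  obtain ⟨τ, h⟩ := Kap_eq_stopped η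
  refine ContinuousOn.congr (f := fun t => ∫ x, φ x ∂(η.toFun (min t τ))) ?_
    fun t ht => by simp only [h t ht]
  exact ((η.narrow φ hφ).comp (continuous_id.min continuous_const)).continuousOn

lemma char_zero {v : XX d → Euc d} {g : XX d → ℝ} {η : SCurve V} (hη : MemHvg V v g η)
    {φ : XX d → ℝ} (hφ : IsTest φ)
    (hFint : Integrable (fun t => ∫ x, FF v g φ (t, x) ∂(Kap V (t, η)))
      (volume.restrict (Ioo (0:ℝ) 1))) :
    ∫ t in Ioo (0:ℝ) 1, ∫ x, FF v g φ (t, x) ∂(Kap V (t, η)) = 0 := by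
  classical
  obtain ⟨γ, h, hrep, h1, h2, h3, h4, h5⟩ := hη
  set G : ℝ → ℝ := fun t => ∫ x, FF v g φ (t, x) ∂(Kap V (t, η)) with hG
  have hmass : ∀ t ∈ Icc (0:ℝ) 1, mass η t = h t := by
    intro t ht
    obtain ⟨p1, -, p3⟩ := hrep t ht
    rw [mass, p3]
    simp [Measure.real, p1]
  have hGval : ∀ t ∈ Icc (0:ℝ) 1, (t, η) ∈ Aset V → G t = h t * FF v g φ (t, γ t) := by
    intro t ht hA
    obtain ⟨p1, -, p3⟩ := hrep t ht
    simp only [hG]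
    rw [Kap_apply, if_pos hA]
    simp only
    rw [p3, integral_smul_measure, integral_dirac, ENNReal.toReal_ofReal p1, smul_eq_mul]
  have hGint : IntervalIntegrable G volume 0 1 := by
    rw [intervalIntegrable_iff_integrableOn_Ioo_of_le zero_le_one]
    exact hFint
  have key : ∀ b ∈ Icc (0:ℝ) 1, (∀ t ∈ Icc 0 b, 0 < mass η t) →
      ∫ t in (0:ℝ)..b, G t = mass η b * φ (b, γ b) := by
    intro b hb hpos
    rw [hmass b hb, ← char_ftc h1 h2 h3 h4 h5 hφ hb
      (fun t ht => hmass t ⟨ht.1, ht.2.trans hb.2⟩ ▸ hpos t ht)]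
    refine intervalIntegral.integral_congr fun t ht => ?_
    rw [uIcc_of_le hb.1] at ht
    exact hGval t ⟨ht.1, ht.2.trans hb.2⟩
      ((mem_Aset ht.1).2 fun s hs => hpos s ⟨hs.1, hs.2.trans ht.2⟩)
  rw [← integral_Ioc_eq_integral_Ioo, ← intervalIntegral.integral_of_le zero_le_one]
  change ∫ t in (0:ℝ)..1, G t = 0
  rcases first_zero η with hp | ⟨τ, hτ, h0, hp⟩
  · rw [key 1 (by simp) hp, test_zero hφ (by simp), mul_zero]
  · have hτ0 : ∫ t in τ..1, G t = 0 := by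
      rw [← intervalIntegral.integral_zero (a := τ) (b := 1) (μ := volume)]
      refine intervalIntegral.integral_congr fun t ht => ?_
      rw [uIcc_of_le hτ.2] at ht
      have ht0 : 0 ≤ t := hτ.1.trans ht.1
      simp only [hG]
      rw [Kap_apply, if_neg]
      · simp
      · intro hA
        exact absurd ((mem_Aset ht0).1 hA τ ⟨hτ.1, ht.1⟩) (by simp [h0])
    have hmτ : τ ∈ uIcc (0:ℝ) 1 := by rwa [uIcc_of_le zero_le_one]
    have i1 : IntervalIntegrable G volume 0 τ :=
      hGint.mono_set (uIcc_subset_uIcc left_mem_uIcc hmτ)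
    have i2 : IntervalIntegrable G volume τ 1 :=
      hGint.mono_set (uIcc_subset_uIcc hmτ right_mem_uIcc)
    rw [← intervalIntegral.integral_add_adjacent_intervals i1 i2, hτ0, add_zero]
    rcases hτ.1.eq_or_lt with h00 | hτpos
    · rw [← h00]; simp
    obtain ⟨C, hC⟩ := hφ.2.1.exists_bound_of_continuous hφ.1.continuous
    have hcont : ContinuousOn (fun b => |∫ t in (0:ℝ)..b, G t|) (Icc 0 τ) := by
      have := intervalIntegral.continuousOn_primitive_interval' i1 left_mem_uIcc
      rw [uIcc_of_le hτ.1] at this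
      exact this.abs
    have hle : ∀ b ∈ Ico 0 τ, |∫ t in (0:ℝ)..b, G t| ≤ mass η b * C := by
      intro b hb
      rw [key b ⟨hb.1, hb.2.le.trans hτ.2⟩ (fun t ht => hp t ⟨ht.1, ht.2.trans_lt hb.2⟩),
        abs_mul, abs_of_nonneg (mass_nonneg _ _)]
      exact mul_le_mul_of_nonneg_left (hC _) (mass_nonneg _ _)
    have hcl : closure (Ico 0 τ) = Icc 0 τ := closure_Ico hτpos.ne
    have hfin := le_on_closure hle (hcl ▸ hcont)
      (hcl ▸ ((mass_cont η).mul continuous_const).continuousOn) (x := τ)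
      (hcl ▸ right_mem_Icc.2 hτ.1)
    simp only [h0, zero_mul] at hfin
    exact abs_nonpos_iff.1 hfin

/-- Superposition of the time-`t` values of a kernel. -/
def bnd (K : ProbabilityTheory.Kernel (ℝ × SCurve V) (Euc d)) (σ : Measure (SCurve V)) (t : ℝ) :
    Measure (Euc d) := σ.bind (K.comap (Prod.mk t) measurable_prodMk_left)

lemma lintegral_bnd (K : ProbabilityTheory.Kernel (ℝ × SCurve V) (Euc d)) (σ : Measure (SCurve V))
    (t : ℝ) {f : Euc d → ℝ≥0∞} (hf : Measurable f) :
    ∫⁻ x, f x ∂(bnd K σ t) = ∫⁻ η, ∫⁻ x, f x ∂(K (t, η)) ∂σ :=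
  Measure.lintegral_bind (ProbabilityTheory.Kernel.aemeasurable _) hf.aemeasurable

lemma bnd_apply (K : ProbabilityTheory.Kernel (ℝ × SCurve V) (Euc d)) (σ : Measure (SCurve V))
    (t : ℝ) {s : Set (Euc d)} (hs : MeasurableSet s) :
    bnd K σ t s = ∫⁻ η, K (t, η) s ∂σ :=
  Measure.bind_apply hs (ProbabilityTheory.Kernel.aemeasurable _)

lemma integral_bnd (K : ProbabilityTheory.Kernel (ℝ × SCurve V) (Euc d)) (σ : Measure (SCurve V))
    (t : ℝ) {f : Euc d → ℝ} (hf : Integrable f (bnd K σ t)) :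
    ∫ x, f x ∂(bnd K σ t) = ∫ η, ∫ x, f x ∂(K (t, η)) ∂σ := by
  unfold bnd at *
  rw [Measure.comp_eq_comp_const_apply] at *
  rw [ProbabilityTheory.Kernel.integral_comp hf]
  rfl

lemma le_supMass (η : SCurve V) {t : ℝ} (ht : t ∈ Icc (0:ℝ) 1) : η.toFun t univ ≤ supMass η :=
  le_iSup₂ (f := fun t (_ : t ∈ Icc (0:ℝ) 1) => η.toFun t univ) t ht

lemma toFun_univ (η : SCurve V) (t : ℝ) : η.toFun t univ = ENNReal.ofReal (mass η t) := by
  rw [mass, ofReal_measureReal]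

lemma measurable_supMass : Measurable (supMass (V := V)) := by
  have : supMass (V := V) = fun η => ⨆ q : ℚ, ENNReal.ofReal (mass η (clamp q)) := by
    funext η
    apply le_antisymm
    · refine iSup₂_le fun t ht => ?_
      rw [toFun_univ, ← clamp_of_mem ht]
      have hc : Continuous fun r : ℝ => ENNReal.ofReal (mass η (clamp r)) :=
        ENNReal.continuous_ofReal.comp ((mass_cont η).comp clamp_cont)
      have hcl : IsClosed {r : ℝ | ENNReal.ofReal (mass η (clamp r)) ≤
          ⨆ q : ℚ, ENNReal.ofReal (mass η (clamp q))} := isClosed_le hc continuous_const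
      exact (Rat.denseRange_cast (𝕜 := ℝ)).induction_on
        (p := fun r => ENNReal.ofReal (mass η (clamp r)) ≤
          ⨆ q : ℚ, ENNReal.ofReal (mass η (clamp q))) t hcl
        (fun q => le_iSup (fun q : ℚ => ENNReal.ofReal (mass η (clamp q))) q)
    · refine iSup_le fun q => ?_
      rw [← toFun_univ]
      exact le_supMass η (clamp_mem _)
  rw [this]
  refine Measurable.iSup fun q => ?_
  exact (measurable_mass.comp (measurable_prodMk_left (x := clamp (q:ℝ)))).ennreal_ofReal

lemma supMass_lt_top (η : SCurve V) : supMass η < ⊤ := by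
  obtain ⟨C, hC⟩ := mass_bdd η
  refine lt_of_le_of_lt (iSup₂_le fun t _ => ?_) (ENNReal.ofReal_lt_top (r := C))
  rw [toFun_univ]
  exact ENNReal.ofReal_le_ofReal (hC t)

lemma Kap_mass_le (η : SCurve V) {t : ℝ} (ht : t ∈ Icc (0:ℝ) 1) :
    Kap V (t, η) univ ≤ supMass η := (Kap_le (t, η) univ).trans (le_supMass η ht)

/-- Superposition solutions built from truncated curves. -/
def rhoT (σ : Measure (SCurve V)) : ℝ → Measure (Euc d) := bnd (Kap V) σ

lemma toFun_compl (hV : MeasurableSet V) (η : SCurve V) (t : ℝ) : η.toFun t Vᶜ = 0 := by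
  obtain ⟨a, x, ha, hx, h⟩ := η.cone t
  rw [h]
  simp [hV, hx]

lemma rhoT_le (σ : Measure (SCurve V)) (t : ℝ) : rhoT σ t ≤ bnd (kap V) σ t := by
  refine Measure.le_iff.2 fun s hs => ?_
  rw [rhoT, bnd_apply _ _ _ hs, bnd_apply _ _ _ hs]
  exact lintegral_mono fun η => Kap_le (t, η) s

lemma bnd_univ_le (σ : Measure (SCurve V)) {t : ℝ} (ht : t ∈ Icc (0:ℝ) 1) :
    bnd (kap V) σ t univ ≤ ∫⁻ η, supMass η ∂σ := by
  rw [bnd_apply _ _ _ MeasurableSet.univ]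
  exact lintegral_mono fun η => le_supMass η ht

lemma bnd_compl (hV : MeasurableSet V) (σ : Measure (SCurve V)) (t : ℝ) :
    bnd (kap V) σ t Vᶜ = 0 := by
  rw [bnd_apply _ _ _ hV.compl]
  simp [kap_apply, toFun_compl hV]

lemma rhoT_zero (σ : Measure (SCurve V)) : rhoT σ 0 = bnd (kap V) σ 0 := by
  classical
  have : ∀ η : SCurve V, Kap V (0, η) = kap V (0, η) := by
    intro η
    rw [Kap_apply, kap_apply]
    split_ifs with h
    · rfl
    · symm
      apply toFun_eq_zero
      by_contra h0
      refine h ((mem_Aset le_rfl).2 fun s hs => ?_)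
      have hs0 : s = 0 := le_antisymm hs.2 hs.1
      rw [hs0]
      exact lt_of_le_of_ne (mass_nonneg _ _) (Ne.symm h0)
  ext s hs
  rw [rhoT, bnd_apply _ _ _ hs, bnd_apply _ _ _ hs]
  simp only [this]

/-- Continuous functions are integrable with respect to a finite measure concentrated
on a compact set. -/
lemma integrable_of_conc {V : Set (Euc d)} (hV : IsCompact V) {μ : Measure (Euc d)}
    [IsFiniteMeasure μ] (hμ : μ Vᶜ = 0) {φ : Euc d → ℝ} (hφ : Continuous φ) :
    Integrable φ μ := by
  obtain ⟨C, hC⟩ := hV.exists_bound_of_continuousOn hφ.continuousOn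
  refine Integrable.of_bound hφ.aestronglyMeasurable C ?_
  have : ∀ᵐ x ∂μ, x ∈ V := hμ
  filter_upwards [this] with x hx using hC x hx

lemma rho_eq {ρ : ℝ → Measure (Euc d)} (hV : IsCompact V) {σ : Measure (SCurve V)}
    (hσ1 : (∫⁻ η, supMass η ∂σ) < ⊤)
    (hrepr : ∀ t ∈ Icc (0:ℝ) 1, ∀ φ : Euc d → ℝ, Continuous φ →
      (∫ x, φ x ∂(ρ t)) = ∫ η, (∫ x, φ x ∂(η.toFun t)) ∂σ)
    (hfin : ∀ t ∈ Icc (0:ℝ) 1, ρ t univ ≠ ⊤) {t : ℝ} (ht : t ∈ Icc (0:ℝ) 1) :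
    ρ t = bnd (kap V) σ t := by
  have : IsFiniteMeasure (ρ t) := ⟨(hfin t ht).lt_top⟩
  have : IsFiniteMeasure (bnd (kap V) σ t) := ⟨(bnd_univ_le σ ht).trans_lt hσ1⟩
  refine ext_of_forall_integral_eq_of_IsFiniteMeasure fun f => ?_
  rw [hrepr t ht f f.continuous, integral_bnd]
  · rfl
  · exact integrable_of_conc hV (bnd_compl hV.measurableSet σ t) f.continuous

lemma rhoT_narrow (hV : IsCompact V) {σ : Measure (SCurve V)}
    (hσ1 : (∫⁻ η, supMass η ∂σ) < ⊤) : NarrowCurve V (rhoT σ) := by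
  have hfin : ∀ t ∈ Icc (0:ℝ) 1, rhoT σ t univ < ⊤ := fun t ht =>
    (rhoT_le σ t univ).trans_lt ((bnd_univ_le σ ht).trans_lt hσ1)
  have hco : ∀ t, rhoT σ t Vᶜ = 0 := fun t =>
    le_antisymm ((rhoT_le σ t _).trans (bnd_compl hV.measurableSet σ t).le) (zero_le)
  refine ⟨fun t ht => ⟨hco t, (hfin t ht).ne⟩, fun φ hφ => ?_⟩
  have e : ∀ t ∈ Icc (0:ℝ) 1, ∫ x, φ x ∂(rhoT σ t) = ∫ η, ∫ x, φ x ∂(Kap V (t, η)) ∂σ := by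
    intro t ht
    have : IsFiniteMeasure (rhoT σ t) := ⟨hfin t ht⟩
    exact integral_bnd _ _ _ (integrable_of_conc hV (hco t) hφ)
  refine ContinuousOn.congr ?_ e
  obtain ⟨C, hC⟩ := hV.exists_bound_of_continuousOn hφ.continuousOn
  have hsm : StronglyMeasurable fun p : ℝ × SCurve V => ∫ x, φ x ∂(Kap V p) := by
    exact StronglyMeasurable.integral_kernel_prod_right' (f := fun q => φ q.2)
      (hφ.measurable.comp measurable_snd).stronglyMeasurable
  refine continuousOn_of_dominated (bound := fun η => C * (supMass η).toReal) ?_ ?_ ?_ ?_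
  · intro t _
    exact (hsm.comp_measurable measurable_prodMk_left).aestronglyMeasurable
  · intro t ht
    refine Eventually.of_forall fun η => ?_
    have hfinK : Kap V (t, η) univ < ⊤ := (Kap_mass_le η ht).trans_lt (supMass_lt_top η)
    have : IsFiniteMeasure (Kap V (t, η)) := ⟨hfinK⟩
    have hK : ∀ᵐ x ∂(Kap V (t, η)), ‖φ x‖ ≤ C := by
      have : ∀ᵐ x ∂(Kap V (t, η)), x ∈ V :=
        le_antisymm ((Kap_le (t, η) _).trans (toFun_compl hV.measurableSet η t).le) (zero_le)
      filter_upwards [this] with x hx using hC x hx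
    have hm := Kap_mass_le η ht
    by_cases hC0 : 0 ≤ C
    · refine (norm_integral_le_of_norm_le_const hK).trans ?_
      refine mul_le_mul_of_nonneg_left ?_ hC0
      exact ENNReal.toReal_mono (supMass_lt_top η).ne hm
    · have hVe : V = ∅ := by
        by_contra hne
        obtain ⟨x, hx⟩ := nonempty_iff_ne_empty.2 hne
        exact hC0 ((norm_nonneg _).trans (hC x hx))
      obtain ⟨a, x, ha, hx, h⟩ := η.cone 0
      rw [hVe] at hx
      exact absurd hx (notMem_empty _)
  · refine Integrable.const_mul ?_ C
    exact integrable_toReal_of_lintegral_ne_top measurable_supMass.aemeasurable hσ1.ne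
  · exact Eventually.of_forall fun η => trunc_cont η hφ

lemma FF_measurable {v : XX d → Euc d} {g : XX d → ℝ} (hv : Measurable v) (hg : Measurable g)
    {φ : XX d → ℝ} (hφ : IsTest φ) : Measurable (FF v g φ) := by
  have hc : Continuous (fderiv ℝ φ) := hφ.1.continuous_fderiv (by simp)
  have h1 : Measurable fun p => fderiv ℝ φ p (1, v p) := by
    have hev : Continuous fun q : (XX d →L[ℝ] ℝ) × XX d => q.1 q.2 := by fun_prop
    exact hev.measurable.comp (hc.measurable.prodMk (measurable_const.prodMk hv))
  exact h1.add (hφ.1.continuous.measurable.mul hg)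

lemma FF_bound (v : XX d → Euc d) (g : XX d → ℝ) {φ : XX d → ℝ} (hφ : IsTest φ) :
    ∃ C : ℝ≥0, ∀ p, ‖FF v g φ p‖ₑ ≤ C * (1 + ENNReal.ofReal (‖v p‖ ^ 2 + g p ^ 2)) := by
  have hc : Continuous (fderiv ℝ φ) := hφ.1.continuous_fderiv (by simp)
  obtain ⟨A, hA⟩ := hφ.2.1.exists_bound_of_continuous hφ.1.continuous
  obtain ⟨B, hB⟩ := (hφ.2.1.fderiv (𝕜 := ℝ)).exists_bound_of_continuous hc
  have hA0 : 0 ≤ A := (norm_nonneg _).trans (hA 0)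
  have hB0 : 0 ≤ B := (norm_nonneg _).trans (hB 0)
  refine ⟨(2 * (A + B)).toNNReal, fun p => ?_⟩
  rw [← ENNReal.ofReal_one, ← ENNReal.ofReal_add zero_le_one (by positivity),
    show (((2 * (A + B)).toNNReal : ℝ≥0) : ℝ≥0∞) = ENNReal.ofReal (2 * (A + B)) from rfl,
    ← ENNReal.ofReal_mul (by positivity), ← ofReal_norm]
  refine ENNReal.ofReal_le_ofReal ?_
  have h1 : ‖fderiv ℝ φ p (1, v p)‖ ≤ B * (1 + ‖v p‖) := by
    refine ((fderiv ℝ φ p).le_opNorm _).trans ?_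
    refine mul_le_mul (hB p) ?_ (norm_nonneg _) hB0
    rw [Prod.norm_def]
    simp only [norm_one]
    exact max_le (by linarith [norm_nonneg (v p)]) (by linarith)
  have h2 : ‖φ p * g p‖ ≤ A * |g p| := by
    rw [norm_mul]
    exact mul_le_mul_of_nonneg_right (hA p) (abs_nonneg _)
  have h3 : ‖FF v g φ p‖ ≤ B * (1 + ‖v p‖) + A * |g p| :=
    (norm_add_le _ _).trans (add_le_add h1 h2)
  have h4 : ‖v p‖ ≤ 1 + ‖v p‖ ^ 2 := by nlinarith [sq_nonneg (‖v p‖ - 1)]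
  have h5 : |g p| ≤ 1 + g p ^ 2 := by nlinarith [sq_nonneg (|g p| - 1), sq_abs (g p)]
  nlinarith [mul_le_mul_of_nonneg_left h4 hB0, mul_le_mul_of_nonneg_left h5 hA0,
    mul_nonneg hB0 (sq_nonneg (g p)), mul_nonneg hA0 (sq_nonneg ‖v p‖),
    mul_nonneg hB0 (sq_nonneg ‖v p‖), mul_nonneg hA0 (sq_nonneg (g p))]

lemma rhoT_solves {v : XX d → Euc d} {g : XX d → ℝ} (hv : Measurable v) (hg : Measurable g)
    {σ : Measure (SCurve V)} (hσfin : IsFiniteMeasure σ)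
    (hσ1 : (∫⁻ η, supMass η ∂σ) < ⊤)
    (hconc : σ {η | ¬ MemHvg V v g η} = 0)
    (hen : EnergyVG (rhoT σ) v g < ⊤) : SolvesCE (rhoT σ) v g := by
  intro φ hφ
  change ∫ t in Ioo (0:ℝ) 1, ∫ x, FF v g φ (t, x) ∂(rhoT σ t) = 0
  have hF := FF_measurable hv hg hφ
  obtain ⟨C, hC⟩ := FF_bound v g hφ
  set μ := (volume : Measure ℝ).restrict (Ioo (0:ℝ) 1) with hμ
  have hmE : Measurable fun q : (ℝ × SCurve V) × Euc d => ‖FF v g φ (q.1.1, q.2)‖ₑ :=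
    (hF.comp ((measurable_fst.comp measurable_fst).prodMk measurable_snd)).enorm
  have hIn : Measurable fun p : ℝ × SCurve V => ∫⁻ x, ‖FF v g φ (p.1, x)‖ₑ ∂(Kap V p) :=
    hmE.lintegral_kernel_prod_right
  have hbt : ∀ t, ∫⁻ x, ‖FF v g φ (t, x)‖ₑ ∂(rhoT σ t) =
      ∫⁻ η, ∫⁻ x, ‖FF v g φ (t, x)‖ₑ ∂(Kap V (t, η)) ∂σ := fun t =>
    lintegral_bnd _ _ _ (hF.comp measurable_prodMk_left).enorm
  have hmt : Measurable fun t => ∫⁻ x, ‖FF v g φ (t, x)‖ₑ ∂(rhoT σ t) := by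
    simp only [hbt]
    exact hIn.lintegral_prod_right'
  have hTV : ∫⁻ t, rhoT σ t univ ∂μ < ⊤ := by
    refine lt_of_le_of_lt (lintegral_mono_ae (g := fun _ => ∫⁻ η, supMass η ∂σ) ?_) ?_
    · rw [hμ]
      filter_upwards [ae_restrict_mem measurableSet_Ioo] with t ht
      exact (rhoT_le σ t univ).trans (bnd_univ_le σ (Ioo_subset_Icc_self ht))
    · rw [lintegral_const, hμ]
      simpa using hσ1
  have hmU : Measurable fun t => rhoT σ t univ := by
    have : ∀ t, rhoT σ t univ = ∫⁻ η, Kap V (t, η) univ ∂σ := fun t =>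
      bnd_apply _ _ _ MeasurableSet.univ
    simp only [this]
    exact ((Kap V).measurable_coe MeasurableSet.univ).lintegral_prod_right'
  have htot : ∫⁻ t, ∫⁻ x, ‖FF v g φ (t, x)‖ₑ ∂(rhoT σ t) ∂μ < ⊤ := by
    calc ∫⁻ t, ∫⁻ x, ‖FF v g φ (t, x)‖ₑ ∂(rhoT σ t) ∂μ
        ≤ ∫⁻ t, C * (rhoT σ t univ +
          ∫⁻ x, ENNReal.ofReal (‖v (t, x)‖ ^ 2 + g (t, x) ^ 2) ∂(rhoT σ t)) ∂μ := by
          refine lintegral_mono fun t => ?_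
          refine (lintegral_mono fun x => hC (t, x)).trans ?_
          rw [lintegral_const_mul' _ _ ENNReal.coe_ne_top, lintegral_add_left measurable_const,
            lintegral_const, one_mul]
      _ = C * (∫⁻ t, rhoT σ t univ ∂μ + EnergyVG (rhoT σ) v g) := by
          rw [lintegral_const_mul' _ _ ENNReal.coe_ne_top, lintegral_add_left hmU]
          rfl
      _ < ⊤ := ENNReal.mul_lt_top ENNReal.coe_lt_top (ENNReal.add_lt_top.2 ⟨hTV, hen⟩)
  set H : ℝ → SCurve V → ℝ := fun t η => ∫ x, FF v g φ (t, x) ∂(Kap V (t, η)) with hH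
  have hHm : StronglyMeasurable (Function.uncurry H) :=
    StronglyMeasurable.integral_kernel_prod_right' (κ := Kap V)
      (f := fun q : (ℝ × SCurve V) × Euc d => FF v g φ (q.1.1, q.2))
      (hF.comp ((measurable_fst.comp measurable_fst).prodMk measurable_snd)).stronglyMeasurable
  have hHi : Integrable (Function.uncurry H) (μ.prod σ) := by
    refine ⟨hHm.aestronglyMeasurable, ?_⟩
    rw [HasFiniteIntegral, lintegral_prod _ hHm.enorm.aemeasurable]
    refine lt_of_le_of_lt ?_ htot
    simp only [hbt]
    refine lintegral_mono fun t => lintegral_mono fun η => ?_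
    exact enorm_integral_le_lintegral_enorm _
  have e1 : ∫ t, ∫ x, FF v g φ (t, x) ∂(rhoT σ t) ∂μ = ∫ t, ∫ η, H t η ∂σ ∂μ := by
    refine integral_congr_ae ?_
    filter_upwards [ae_lt_top hmt htot.ne] with t ht
    exact integral_bnd _ _ _ ⟨(hF.comp measurable_prodMk_left).aestronglyMeasurable, ht⟩
  rw [e1, integral_integral_swap hHi]
  refine integral_eq_zero_of_ae ?_
  have hc : ∀ᵐ η ∂σ, MemHvg V v g η := ae_iff.2 hconc
  filter_upwards [hc, hHi.prod_left_ae] with η h1 h2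
  exact char_zero h1 hφ h2

lemma energy_le {v : XX d → Euc d} {g : XX d → ℝ} {ρ ρ' : ℝ → Measure (Euc d)}
    (h : ∀ t ∈ Icc (0:ℝ) 1, ρ' t ≤ ρ t) : EnergyVG ρ' v g ≤ EnergyVG ρ v g := by
  refine lintegral_mono_ae ?_
  filter_upwards [ae_restrict_mem measurableSet_Ioo] with t ht
  exact lintegral_mono' (h t (Ioo_subset_Icc_self ht)) le_rfl

lemma memSstar_of_ae {η : SCurve V}
    (h : ∀ᵐ t ∂((volume : Measure ℝ).restrict (Ioo (0:ℝ) 1)), (t, η) ∈ Aset V ∨ mass η t = 0) :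
    MemSstar η := by
  have hne : ∀ t, η.toFun t univ ≠ 0 ↔ 0 < mass η t := by
    intro t
    rw [toFun_univ, ne_eq, ENNReal.ofReal_eq_zero, not_le]
  rcases first_zero η with h0 | ⟨τ, hτ, hz, hp⟩
  · refine ⟨2, ?_⟩
    ext t
    simp only [mem_ofPred_eq, hne, mem_inter_iff, mem_Iio]
    constructor
    · rintro ⟨h1, _⟩
      exact ⟨h1, by linarith [h1.2]⟩
    · rintro ⟨h1, _⟩
      exact ⟨h1, h0 t h1⟩
  · have key : ∀ t ∈ Icc τ 1, mass η t = 0 := by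
      rcases hτ.2.eq_or_lt with h1 | h1
      · intro t ht
        have : t = τ := le_antisymm (ht.2.trans h1.ge) ht.1
        rw [this, hz]
      · have := Measure.eqOn_Icc_of_ae_eq (volume : Measure ℝ) (f := mass η) (g := fun _ => 0)
          h1.ne ?_ (mass_cont η).continuousOn continuousOn_const
        · exact this
        · rw [← restrict_Ioo_eq_restrict_Icc]
          have hs : Ioo τ 1 ⊆ Ioo (0:ℝ) 1 := Ioo_subset_Ioo_left hτ.1
          filter_upwards [ae_mono (Measure.restrict_mono hs le_rfl) h,
            ae_restrict_mem measurableSet_Ioo] with t ht htm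
          rcases ht with ht | ht
          · have := (mem_Aset (hτ.1.trans htm.1.le)).1 ht τ ⟨hτ.1, htm.1.le⟩
            rw [hz] at this
            exact absurd this (lt_irrefl _)
          · exact ht
    refine ⟨τ, ?_⟩
    ext t
    simp only [mem_ofPred_eq, hne, mem_inter_iff, mem_Iio]
    constructor
    · rintro ⟨h1, h2⟩
      refine ⟨h1, ?_⟩
      by_contra h3
      rw [key t ⟨not_lt.1 h3, h1.2⟩] at h2
      exact lt_irrefl _ h2
    · rintro ⟨h1, h2⟩
      exact ⟨h1, hp t ⟨h1.1, h2⟩⟩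

lemma ae_good {σ : Measure (SCurve V)} (hσfin : IsFiniteMeasure σ)
    (hσ1 : (∫⁻ η, supMass η ∂σ) < ⊤)
    (hle : ∫⁻ t in Ioo (0:ℝ) 1, bnd (kap V) σ t univ ≤ ∫⁻ t in Ioo (0:ℝ) 1, rhoT σ t univ) :
    ∀ᵐ η ∂σ, ∀ᵐ t ∂((volume : Measure ℝ).restrict (Ioo (0:ℝ) 1)),
      (t, η) ∈ Aset V ∨ mass η t = 0 := by
  classical
  set μ := (volume : Measure ℝ).restrict (Ioo (0:ℝ) 1) with hμ
  have m1 : Measurable fun p : ℝ × SCurve V => kap V p univ :=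
    (kap V).measurable_coe MeasurableSet.univ
  have m2 : Measurable fun p : ℝ × SCurve V => Kap V p univ :=
    (Kap V).measurable_coe MeasurableSet.univ
  have e1 : ∫⁻ t, bnd (kap V) σ t univ ∂μ = ∫⁻ p, kap V p univ ∂(μ.prod σ) := by
    rw [lintegral_prod _ m1.aemeasurable]
    exact lintegral_congr fun t => bnd_apply _ _ _ MeasurableSet.univ
  have e2 : ∫⁻ t, rhoT σ t univ ∂μ = ∫⁻ p, Kap V p univ ∂(μ.prod σ) := by
    rw [lintegral_prod _ m2.aemeasurable]
    exact lintegral_congr fun t => bnd_apply _ _ _ MeasurableSet.univ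
  have hfin : ∫⁻ p, Kap V p univ ∂(μ.prod σ) ≠ ⊤ := by
    rw [← e2]
    refine ne_of_lt (lt_of_le_of_lt
      (lintegral_mono_ae (g := fun _ => ∫⁻ η, supMass η ∂σ) ?_) ?_)
    · rw [hμ]
      filter_upwards [ae_restrict_mem measurableSet_Ioo] with t ht
      exact (rhoT_le σ t univ).trans (bnd_univ_le σ (Ioo_subset_Icc_self ht))
    · rw [lintegral_const, hμ]
      simpa using hσ1
  rw [e1, e2] at hle
  have hae := ae_eq_of_ae_le_of_lintegral_le (μ := μ.prod σ)
    (f := fun p => Kap V p univ) (g := fun p => kap V p univ)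
    (Eventually.of_forall fun p => Kap_le p univ) hfin m1.aemeasurable hle
  have hae2 : ∀ᵐ p ∂(μ.prod σ), p ∈ Aset V ∨ mass p.2 p.1 = 0 := by
    filter_upwards [hae] with p hp
    by_cases hA : p ∈ Aset V
    · exact Or.inl hA
    · right
      simp only [Kap_apply, if_neg hA, kap_apply] at hp
      rw [mass, Measure.real, ← hp]
      simp
  have := (Measure.measurePreserving_swap (μ := σ) (ν := μ)).quasiMeasurePreserving.ae hae2
  exact Measure.ae_ae_of_ae_prod this

lemma main_aux (Ω : Set (Euc d))
    (hΩ : IsClosureOfBoundedDomain Ω)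
    (v : XX d → Euc d) (g : XX d → ℝ) (hv : Measurable v) (hg : Measurable g)
    (ρ : ℝ → Measure (Euc d)) (hρ : Dvg Ω v g ρ)
    (σ : Measure (SCurve Ω)) (hσfin : IsFiniteMeasure σ)
    (hσ1 : (∫⁻ η, supMass η ∂σ) < ⊤)
    (hconc : σ {η | ¬ MemHvg Ω v g η} = 0)
    (hrepr : ∀ t ∈ Icc (0:ℝ) 1, ∀ φ : Euc d → ℝ, Continuous φ →
      (∫ x, φ x ∂(ρ t)) = ∫ η, (∫ x, φ x ∂(η.toFun t)) ∂σ)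
    (hmin : ∀ ρ' : ℝ → Measure (Euc d), Dvg Ω v g ρ' → ρ' 0 = ρ 0 →
      TVcurve ρ ≤ TVcurve ρ') :
    σ {η | ¬ MemSstar η} = 0 := by
  have hcomp : IsCompact Ω := by
    obtain ⟨U, -, -, -, hb, rfl⟩ := hΩ
    exact hb.isCompact_closure
  have heq : ∀ t ∈ Icc (0:ℝ) 1, ρ t = bnd (kap Ω) σ t := fun t ht =>
    rho_eq hcomp hσ1 hrepr (fun t ht => (hρ.1.1 t ht).2) ht
  have hen : EnergyVG (rhoT σ) v g < ⊤ :=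
    (energy_le fun t ht => (heq t ht).symm ▸ rhoT_le σ t).trans_lt hρ.2.2
  have hD : Dvg Ω v g (rhoT σ) :=
    ⟨rhoT_narrow hcomp hσ1, rhoT_solves hv hg hσfin hσ1 hconc hen, hen⟩
  have hTV := hmin (rhoT σ) hD (by rw [rhoT_zero, heq 0 (by simp)])
  have hTV2 : ∫⁻ t in Ioo (0:ℝ) 1, bnd (kap Ω) σ t univ ≤
      ∫⁻ t in Ioo (0:ℝ) 1, rhoT σ t univ := by
    refine le_trans (le_of_eq ?_) hTV
    refine setLIntegral_congr_fun measurableSet_Ioo fun t ht => ?_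
    simp only [heq t (Ioo_subset_Icc_self ht)]
  have := ae_good hσfin hσ1 hTV2
  refine ae_iff.1 ?_
  filter_upwards [this] with η hη using memSstar_of_ae hη


end Helpers

/-- **Minimal total variation forces concentration on curves vanishing only once.**
If `ρ ∈ D_{v,g}` is represented by `σ ∈ M⁺₁(𝒮_Ω)` concentrated on `H_Ω^{v,g}`
and has minimal total variation among solutions with the same initial datum,
then `σ` is concentrated on `𝒮*_Ω`. -/
theorem minimal_TV_concentration (d : ℕ) (hd : 1 ≤ d) (Ω : Set (Euc d))
    (hΩ : IsClosureOfBoundedDomain Ω)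
    (v : XX d → Euc d) (g : XX d → ℝ) (hv : Measurable v) (hg : Measurable g)
    (ρ : ℝ → Measure (Euc d)) (hρ : Dvg Ω v g ρ)
    (σ : Measure (SCurve Ω)) (hσfin : IsFiniteMeasure σ)
    (hσ1 : (∫⁻ η, supMass η ∂σ) < ⊤)
    (hconc : σ {η | ¬ MemHvg Ω v g η} = 0)
    (hrepr : ∀ t ∈ Icc (0:ℝ) 1, ∀ φ : Euc d → ℝ, Continuous φ →
      (∫ x, φ x ∂(ρ t)) = ∫ η, (∫ x, φ x ∂(η.toFun t)) ∂σ)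
    (hmin : ∀ ρ' : ℝ → Measure (Euc d), Dvg Ω v g ρ' → ρ' 0 = ρ 0 →
      TVcurve ρ ≤ TVcurve ρ') :
    σ {η | ¬ MemSstar η} = 0 := by
  exact main_aux Ω hΩ v g hv hg ρ hρ σ hσfin hσ1 hconc hrepr hmin

end Paper
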